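/- Let P_{A,E} be a normalized joint distribution on 𝒜 × ℰ and suppose V(P_{A,E}) := ∑_{(a,e): P_{A,E}(a,e)>0} P_{A,E}(a,e)·(−log P_{A|E}(a|e) − H(A|E|P_{A,E}))² > 0. Then for every R ∈ ℝ and every polynomial P(n) taking positive values, limsup_{n→∞} Δ_{d,min}(e^{n·H(A|E|P_{A,E}) + √n·R}, P(n) | P_{A,E}^n) ≤ 2·∫_{−∞}^{R/√V(P_{A,E})} (1/√(2π))·e^{−x²/2} dx. -/

import Mathlib

open Real Finset Filter

attribute [local instance] Classical.propDecidable

namespace Hayashi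

def IsSubDist {S : Type*} [Fintype S] (P : S → ℝ) : Prop :=
  (∀ x, 0 ≤ P x) ∧ ∑ x, P x ≤ 1

def IsDist {S : Type*} [Fintype S] (P : S → ℝ) : Prop :=
  (∀ x, 0 ≤ P x) ∧ ∑ x, P x = 1

variable {A E : Type*} [Fintype A] [Fintype E]

noncomputable def margE (P : A × E → ℝ) (e : E) : ℝ := ∑ a, P (a, e)

noncomputable def margNorm (P : A × E → ℝ) (e : E) : ℝ := margE P e / ∑ e', margE P e'

noncomputable def l1 (P P' : A × E → ℝ) : ℝ := ∑ a, ∑ e, |P (a, e) - P' (a, e)|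

noncomputable def eta (x y : ℝ) : ℝ := -x * Real.log x + x * y

noncomputable def condRenyi (P : A × E → ℝ) (Q : E → ℝ) (s : ℝ) : ℝ :=
  (-1 / s) * Real.log (∑ a, ∑ e, P (a, e) ^ (1 + s) * Q e ^ (-s))

noncomputable def condRenyiUp (P : A × E → ℝ) (s : ℝ) : ℝ :=
  sSup {x | ∃ Q : E → ℝ, IsDist Q ∧ (∀ e, 0 < Q e) ∧ x = condRenyi P Q s}

noncomputable def condRenyiDown (P : A × E → ℝ) (s : ℝ) : ℝ :=
  condRenyi P (margNorm P) s

noncomputable def condEnt (P : A × E → ℝ) : ℝ :=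
  -∑ a, ∑ e, P (a, e) * Real.log (P (a, e) / margE P e)

noncomputable def H2cond (P : A × E → ℝ) (Q : E → ℝ) : ℝ :=
  -Real.log (∑ a, ∑ e, P (a, e) ^ 2 / Q e)

noncomputable def d2cond (P : A × E → ℝ) (Q : E → ℝ) : ℝ :=
  ∑ a, ∑ e, (P (a, e) - margE P e / (Fintype.card A : ℝ)) ^ 2 / Q e

noncomputable def d1' (P : A × E → ℝ) : ℝ :=
  ∑ a, ∑ e, |P (a, e) - margE P e / (Fintype.card A : ℝ)|

noncomputable def Iprime (P : A × E → ℝ) : ℝ :=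
  ∑ a, ∑ e, P (a, e) * Real.log (P (a, e) * (Fintype.card A : ℝ) / margE P e)

noncomputable def Hmin (P : A × E → ℝ) (Q : E → ℝ) : ℝ :=
  -Real.log (sSup {r | ∃ a e, 0 < Q e ∧ r = P (a, e) / Q e})

noncomputable def D2div {E : Type*} [Fintype E] (P Q : E → ℝ) : ℝ :=
  Real.log (∑ e, P e ^ 2 / Q e)

noncomputable def pushHash {B : Type*} (f : A → B) (P : A × E → ℝ) : B × E → ℝ :=
  fun be => ∑ a, (if f a = be.1 then P (a, be.2) else 0)

noncomputable def Delta_d2 (M ε : ℝ) (P : A × E → ℝ) : ℝ :=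
  sInf {x | ∃ (Q : E → ℝ) (P' : A × E → ℝ), IsDist Q ∧ (∀ e, 0 < Q e) ∧ IsSubDist P' ∧
    x = 2 * l1 P P' + Real.sqrt ε * Real.sqrt M * Real.exp (-H2cond P' Q / 2)}

noncomputable def Delta_I2 (M ε : ℝ) (P : A × E → ℝ) : ℝ :=
  sInf {x | ∃ P' : A × E → ℝ, IsSubDist P' ∧ (∀ e, margE P' e ≤ margE P e) ∧
    x = eta (l1 P P') (Real.log M) + ε * M * Real.exp (-H2cond P' (margE P))}

noncomputable def Delta_dmin (M ε : ℝ) (P : A × E → ℝ) : ℝ :=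
  sInf {x | ∃ (Q : E → ℝ) (P' : A × E → ℝ), IsDist Q ∧ (∀ e, 0 < Q e) ∧ IsSubDist P' ∧
    x = 2 * l1 P P' + Real.sqrt ε * Real.sqrt M * Real.exp (-Hmin P' Q / 2)}

noncomputable def Delta_Imin (M ε : ℝ) (P : A × E → ℝ) : ℝ :=
  sInf {x | ∃ P' : A × E → ℝ, IsSubDist P' ∧ (∀ e, margE P' e ≤ margE P e) ∧
    x = eta (l1 P P') (Real.log M) + ε * M * Real.exp (-Hmin P' (margE P))}

noncomputable def DeltaBar_Imin (M ε : ℝ) (P : A × E → ℝ) : ℝ :=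
  sInf {x | ∃ P' : A × E → ℝ, IsSubDist P' ∧ (∀ e, margE P' e ≤ margE P e) ∧
    x = eta (l1 P P') (Real.log M) + Real.log (1 + ε * M * Real.exp (-Hmin P' (margE P)))}

noncomputable def Pn (P : A × E → ℝ) (n : ℕ) : (Fin n → A) × (Fin n → E) → ℝ :=
  fun ae => ∏ i, P (ae.1 i, ae.2 i)


/-- The conditional information variance
`V(P) = ∑ P(a,e)·(-log P_{A|E}(a|e) - H(A|E|P))²`. -/
noncomputable def Vval {A E : Type*} [Fintype A] [Fintype E]
    (P : A × E → ℝ) : ℝ :=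
  ∑ a, ∑ e, P (a, e) * (-Real.log (P (a, e) / margE P e) - condEnt P) ^ 2

lemma oneShot {A E : Type*} [Fintype A] [Fintype E] [Nonempty A] [Nonempty E]
    (P : A × E → ℝ) (hP : IsDist P) (m : E → ℝ) (hm : IsDist m)
    (k M ε : ℝ) (hk : 0 < k) :
    Delta_dmin M ε P ≤ 2 * (∑ x, P x * (if k * m x.2 < P x then 1 else 0))
      + Real.sqrt ε * Real.sqrt M * Real.sqrt (2 * k) := by
  have hcard : (0 : ℝ) < Fintype.card E := by exact_mod_cast Fintype.card_pos
  set Q : E → ℝ := fun e => (m e + 1 / Fintype.card E) / 2 with hQdef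
  have hQpos : ∀ e, 0 < Q e := fun e => by
    have := hm.1 e
    have : 0 < 1 / (Fintype.card E : ℝ) := by positivity
    simp only [hQdef]; linarith
  have hQ : IsDist Q := by
    refine ⟨fun e => (hQpos e).le, ?_⟩
    simp only [hQdef]
    rw [← Finset.sum_div, Finset.sum_add_distrib, hm.2]
    simp
  set P' : A × E → ℝ := fun x => min (P x) (2 * k * Q x.2) with hP'def
  have hP'le : ∀ x, P' x ≤ P x := fun x => min_le_left _ _
  have hP'0 : ∀ x, 0 ≤ P' x := fun x =>
    le_min (hP.1 x) (by have := hQpos x.2; positivity)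
  have hP' : IsSubDist P' :=
    ⟨hP'0, (Finset.sum_le_sum fun x _ => hP'le x).trans hP.2.le⟩
  have hl1 : l1 P P' ≤ ∑ x, P x * (if k * m x.2 < P x then 1 else 0) := by
    unfold l1
    rw [← Fintype.sum_prod_type']
    refine Finset.sum_le_sum fun x _ => ?_
    obtain ⟨a, e⟩ := x
    rw [abs_of_nonneg (sub_nonneg.2 (hP'le _))]
    split_ifs with h
    · have := hP'0 (a, e); simp only [mul_one]; linarith
    · have h1 : P' (a, e) = P (a, e) := by
        apply min_eq_left
        have : 0 < 1 / (Fintype.card E : ℝ) := by positivity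
        have h2 : k * m e ≤ 2 * k * Q e := by
          simp only [hQdef]; nlinarith
        simp only at h ⊢
        linarith
      rw [h1]; simp
  -- the supremum
  have hex : ∃ x, 0 < P x := by
    by_contra! hcon
    have := Finset.sum_nonpos (s := Finset.univ) fun x _ => hcon x
    rw [hP.2] at this; linarith
  obtain ⟨⟨a0, e0⟩, h0⟩ := hex
  set S : Set ℝ := {r | ∃ a e, 0 < Q e ∧ r = P' (a, e) / Q e} with hS
  have hub : ∀ r ∈ S, r ≤ 2 * k := by
    rintro r ⟨a, e, he, rfl⟩
    rw [div_le_iff₀ he]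
    exact min_le_right _ _
  have hmem : P' (a0, e0) / Q e0 ∈ S := ⟨a0, e0, hQpos e0, rfl⟩
  have hpos : 0 < P' (a0, e0) / Q e0 := by
    refine div_pos (lt_min h0 ?_) (hQpos _)
    have := hQpos e0
    simp only; positivity
  have hSpos : 0 < sSup S := hpos.trans_le (le_csSup ⟨_, hub⟩ hmem)
  have hSle : sSup S ≤ 2 * k := csSup_le ⟨_, hmem⟩ hub
  have hexp : Real.exp (-Hmin P' Q / 2) ≤ Real.sqrt (2 * k) := by
    have : Hmin P' Q = -Real.log (sSup S) := rfl
    rw [this, neg_neg, Real.exp_half, Real.exp_log hSpos]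
    exact Real.sqrt_le_sqrt hSle
  have hle : Delta_dmin M ε P ≤
      2 * l1 P P' + Real.sqrt ε * Real.sqrt M * Real.exp (-Hmin P' Q / 2) := by
    refine csInf_le ⟨0, ?_⟩ ⟨Q, P', hQ, hQpos, hP', rfl⟩
    rintro x ⟨Q, P', -, -, -, rfl⟩
    have : 0 ≤ l1 P P' := Finset.sum_nonneg fun _ _ => Finset.sum_nonneg fun _ _ => abs_nonneg _
    positivity
  refine hle.trans ?_
  gcongr

lemma Delta_dmin_nonneg {A E : Type*} [Fintype A] [Fintype E] 
    (P : A × E → ℝ) (M ε : ℝ) : 0 ≤ Delta_dmin M ε P := by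
  refine Real.sInf_nonneg ?_
  rintro x ⟨Q, P', -, -, -, rfl⟩
  have : 0 ≤ l1 P P' := Finset.sum_nonneg fun _ _ => Finset.sum_nonneg fun _ _ => abs_nonneg _
  positivity

lemma isDist_prod {S : Type*} [Fintype S] (P : S → ℝ) (hP : IsDist P) (n : ℕ) :
    IsDist (fun s : Fin n → S => ∏ i, P (s i)) := by
  refine ⟨fun s => Finset.prod_nonneg fun i _ => hP.1 _, ?_⟩
  have := (Finset.prod_univ_sum (fun _ : Fin n => (Finset.univ : Finset S)) (fun _ s => P s)).symm
  simp only [Fintype.piFinset_univ] at this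
  rw [this, hP.2]
  simp

open MeasureTheory ProbabilityTheory in
lemma clt_unit {S : Type*} [Fintype S] (P : S → ℝ) (hP : IsDist P) (g : S → ℝ)
    (hmean : ∑ s, P s * g s = 0) (hvar : ∑ s, P s * g s ^ 2 = 1) (u : ℝ) :
    Tendsto (fun n : ℕ => ∑ s : Fin n → S, (∏ i, P (s i)) *
      (if (√n)⁻¹ * ∑ i, g (s i) ≤ u then 1 else 0)) atTop
      (nhds (∫ x in Set.Iic u, (1 / Real.sqrt (2 * Real.pi)) * Real.exp (-x ^ 2 / 2))) := by
  classical
  let _ : MeasurableSpace S := ⊤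
  have : DiscreteMeasurableSpace S := ⟨fun _ => trivial⟩
  have hsum : ∑ s, ENNReal.ofReal (P s) = 1 := by
    rw [← ENNReal.ofReal_sum_of_nonneg (fun s _ => hP.1 s), hP.2]; simp
  set p : PMF S := PMF.ofFintype (fun s => ENNReal.ofReal (P s)) hsum with hp
  set μ : Measure S := p.toMeasure with hμ
  have hμs : ∀ s, μ {s} = ENNReal.ofReal (P s) := fun s => by
    rw [hμ, PMF.toMeasure_apply_singleton _ _ (by measurability)]; rfl
  have hint : ∀ f : S → ℝ, ∫ s, f s ∂μ = ∑ s, P s * f s := fun f => by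
    rw [integral_fintype (.of_finite)]
    refine Finset.sum_congr rfl fun s _ => ?_
    rw [measureReal_def, hμs, ENNReal.toReal_ofReal (hP.1 s), smul_eq_mul]
  obtain ⟨Ω, _, PP, X, hXm, hXlaw, hXind, _⟩ := exists_iid ℕ μ
  have hgm : Measurable g := measurable_of_finite g
  set Y : ℕ → Ω → ℝ := fun i ω => g (X i ω) with hY
  have hYind : iIndepFun Y PP := hXind.comp (fun _ => g) (fun _ => hgm)
  have hid : ∀ i, IdentDistrib (X i) (X 0) PP PP := fun i =>
    ⟨(hXm i).aemeasurable, (hXm 0).aemeasurable, by rw [(hXlaw i).map_eq, (hXlaw 0).map_eq]⟩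
  have hYid : ∀ i, IdentDistrib (Y i) (Y 0) PP PP := fun i => (hid i).comp hgm
  have hE : ∀ f : S → ℝ, ∫ ω, f (X 0 ω) ∂PP = ∑ s, P s * f s := fun f => by
    rw [← hint f, ← (hXlaw 0).map_eq,
      integral_map (hXm 0).aemeasurable (measurable_of_finite f).aestronglyMeasurable]
  have hYmean : ∫ ω, Y 0 ω ∂PP = 0 := by rw [← hmean, ← hE g]
  have hYvar : ∫ ω, (Y 0 ^ 2) ω ∂PP = 1 := by
    rw [← hvar, ← hE (fun s => g s ^ 2)]; rfl
  have hclt := tendstoInDistribution_inv_sqrt_mul_sum (P := PP) (X := Y)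
    (Y := id) (P' := gaussianReal 0 1) .id hYmean hYvar hYind hYid
  have hnull : gaussianReal 0 1 (frontier (Set.Iic u)) = 0 := by
    rw [frontier_Iic]
    exact gaussianReal_absolutelyContinuous 0 one_ne_zero (by simp)
  have hport := ProbabilityMeasure.tendsto_measure_of_null_frontier_of_tendsto' hclt.tendsto
    (E := Set.Iic u) (by simpa using hnull)
  have hlim := (ENNReal.tendsto_toReal (by simp)).comp hport
  convert! hlim using 1
  · ext n
    simp only [Function.comp, ProbabilityMeasure.coe_mk]
    have hmeas : Measurable (fun ω => (√n)⁻¹ * ∑ k ∈ Finset.range n, Y k ω) := by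
      have : ∀ k, Measurable (Y k) := fun k => hgm.comp (hXm k)
      fun_prop
    rw [Measure.map_apply hmeas measurableSet_Iic]
    set T : Set (Fin n → S) := {s | (√n)⁻¹ * ∑ i, g (s i) ≤ u} with hT
    have hZm : Measurable (fun ω (i : Fin n) => X i ω) := by fun_prop
    have hjoint : PP.map (fun ω (i : Fin n) => X i ω) = Measure.pi (fun _ => μ) := by
      have h1 : iIndepFun (fun i : Fin n => X i) PP := hXind.precomp Fin.val_injective
      rw [(iIndepFun_iff_map_fun_eq_pi_map (fun i => (hXm _).aemeasurable)).1 h1]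
      congr 1
      ext1 i
      exact (hXlaw _).map_eq
    have hpre : (fun ω => (√n)⁻¹ * ∑ k ∈ Finset.range n, Y k ω) ⁻¹' Set.Iic u
        = (fun ω (i : Fin n) => X i ω) ⁻¹' T := by
      ext ω
      simp [hT, hY, Finset.sum_range]
    rw [hpre, ← Measure.map_apply hZm (Set.toFinite T).measurableSet, hjoint]
    have hTf : T = ((Finset.univ.filter (· ∈ T) : Finset (Fin n → S)) : Set (Fin n → S)) := by
      ext; simp
    rw [hTf, ← measureReal_def, ← sum_measureReal_singleton, Finset.sum_filter]
    refine Finset.sum_congr rfl fun s _ => ?_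
    have : (s ∈ T) = ((√n)⁻¹ * ∑ i, g (s i) ≤ u) := rfl
    simp only [this]
    have hs : (Measure.pi (fun _ : Fin n => μ)).real {s} = ∏ i, P (s i) := by
      rw [measureReal_def, Measure.pi_singleton, ENNReal.toReal_prod]
      refine Finset.prod_congr rfl fun i _ => ?_
      rw [hμs, ENNReal.toReal_ofReal (hP.1 _)]
    split_ifs <;> simp [hs]
  · simp only [Measure.map_id, ProbabilityMeasure.coe_mk]
    rw [gaussianReal_apply_eq_integral 0 one_ne_zero, ENNReal.toReal_ofReal]
    · simp [gaussianPDFReal]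
    · exact integral_nonneg fun x => gaussianPDFReal_nonneg _ _ _

lemma clt_finite {S : Type*} [Fintype S] (P : S → ℝ) (hP : IsDist P) (g : S → ℝ)
    (hmean : ∑ s, P s * g s = 0) (V : ℝ) (hV : 0 < V) (hvar : ∑ s, P s * g s ^ 2 = V) (u : ℝ) :
    Tendsto (fun n : ℕ => ∑ s : Fin n → S, (∏ i, P (s i)) *
      (if (√(n * V))⁻¹ * ∑ i, g (s i) ≤ u then 1 else 0)) atTop
      (nhds (∫ x in Set.Iic u, (1 / Real.sqrt (2 * Real.pi)) * Real.exp (-x ^ 2 / 2))) := by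
  have h := clt_unit P hP (fun s => g s / √V) ?_ ?_ u
  · have e : ∀ (n : ℕ) (s : Fin n → S), (√(n * V))⁻¹ * ∑ i, g (s i)
        = (√(n : ℝ))⁻¹ * ∑ i, g (s i) / √V := fun n s => by
      rw [← Finset.sum_div, Real.sqrt_mul (Nat.cast_nonneg n), mul_inv, div_eq_mul_inv]
      ring
    simp only [e]
    exact h
  · simp only [← mul_div_assoc, ← Finset.sum_div, hmean, zero_div]
  · simp only [div_pow, Real.sq_sqrt hV.le, ← mul_div_assoc, ← Finset.sum_div, hvar]
    exact div_self hV.ne'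

lemma gauss_cont : Continuous (fun u : ℝ => ∫ x in Set.Iic u,
    (1 / Real.sqrt (2 * Real.pi)) * Real.exp (-x ^ 2 / 2)) := by
  have hi : MeasureTheory.Integrable
      (fun x : ℝ => (1 / Real.sqrt (2 * Real.pi)) * Real.exp (-x ^ 2 / 2)) := by
    have := ProbabilityTheory.integrable_gaussianPDFReal 0 1
    convert this using 2 with x
    simp [ProbabilityTheory.gaussianPDFReal]
  have h : ∀ u : ℝ, ∫ x in Set.Iic u, (1 / Real.sqrt (2 * Real.pi)) * Real.exp (-x ^ 2 / 2)
      = (∫ x in Set.Iic 0, (1 / Real.sqrt (2 * Real.pi)) * Real.exp (-x ^ 2 / 2))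
       + ∫ x in (0 : ℝ)..u, (1 / Real.sqrt (2 * Real.pi)) * Real.exp (-x ^ 2 / 2) := by
    intro u
    rw [← intervalIntegral.integral_Iic_sub_Iic hi.integrableOn hi.integrableOn]
    ring
  rw [funext h]
  exact continuous_const.add
    (intervalIntegral.continuous_primitive (fun a b => hi.intervalIntegrable) 0)

lemma pol_tendsto (Pol : Polynomial ℝ) (δ : ℝ) (hδ : 0 < δ) :
    Tendsto (fun n : ℕ => √(2 * (Pol.eval (n : ℝ) / Real.exp (δ * √n)))) atTop (nhds 0) := by
  have h1 := Polynomial.tendsto_div_exp_atTop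
    (Pol.comp ((Polynomial.C δ⁻¹ * Polynomial.X) ^ 2))
  have h2 : Tendsto (fun n : ℕ => δ * √(n : ℝ)) atTop atTop :=
    (Real.tendsto_sqrt_atTop.comp tendsto_natCast_atTop_atTop).const_mul_atTop hδ
  have h3 := h1.comp h2
  have h4 : ∀ n : ℕ, (δ⁻¹ * (δ * √(n : ℝ))) ^ 2 = n := fun n => by
    rw [inv_mul_cancel_left₀ hδ.ne', Real.sq_sqrt (Nat.cast_nonneg n)]
  simp only [Function.comp_def, Polynomial.eval_comp, Polynomial.eval_pow, Polynomial.eval_mul,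
    Polynomial.eval_C, Polynomial.eval_X, h4] at h3
  have h5 := (Real.continuous_sqrt.tendsto _).comp (h3.const_mul 2)
  simpa [Function.comp_def] using h5

noncomputable def gfun {A E : Type*} [Fintype A] [Fintype E] (P : A × E → ℝ) (x : A × E) : ℝ :=
  -Real.log (P x / margE P x.2) - condEnt P

lemma clt_main {A E : Type*} [Fintype A] [Fintype E]
    (P : A × E → ℝ) (hP : IsDist P) (hV : 0 < Vval P) (u : ℝ) :
    Tendsto (fun n : ℕ => ∑ s : Fin n → A × E, (∏ i, P (s i)) *
      (if (√(n * Vval P))⁻¹ * ∑ i, gfun P (s i) ≤ u then 1 else 0)) atTop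
      (nhds (∫ x in Set.Iic u, (1 / Real.sqrt (2 * Real.pi)) * Real.exp (-x ^ 2 / 2))) := by
  refine clt_finite P hP (gfun P) ?_ (Vval P) hV ?_ u
  · simp only [gfun, mul_sub, Finset.sum_sub_distrib, ← Finset.sum_mul, hP.2]
    simp only [condEnt, Fintype.sum_prod_type]
    simp
  · rw [Vval, Fintype.sum_prod_type]
    rfl

lemma margE_pos {A E : Type*} [Fintype A] [Fintype E] (P : A × E → ℝ) (hP : ∀ x, 0 ≤ P x)
    (x : A × E) (hx : 0 < P x) : 0 < margE P x.2 := by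
  refine hx.trans_le ?_
  exact Finset.single_le_sum (f := fun a => P (a, x.2)) (fun a _ => hP _) (Finset.mem_univ x.1)

lemma step_bound {A E : Type*} [Fintype A] [Fintype E] [Nonempty A] [Nonempty E]
    (P : A × E → ℝ) (hP : IsDist P) (hV : 0 < Vval P) (R δ : ℝ) (Pol : Polynomial ℝ)
    (n : ℕ) (hn : 0 < n) :
    Delta_dmin (Real.exp (n * condEnt P + Real.sqrt (n : ℝ) * R))
          (Pol.eval (n : ℝ)) (Pn P n) ≤
    2 * (∑ s : Fin n → A × E, (∏ i, P (s i)) *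
      (if (√(n * Vval P))⁻¹ * ∑ i, gfun P (s i) ≤ (R + δ) / √(Vval P) then 1 else 0))
      + √(2 * (Pol.eval (n : ℝ) / Real.exp (δ * √n))) := by
  set k := Real.exp (-(n * condEnt P + √n * (R + δ))) with hk
  have hm : IsDist (margE P) := by
    refine ⟨fun e => Finset.sum_nonneg fun a _ => hP.1 _, ?_⟩
    rw [← hP.2, Fintype.sum_prod_type_right]; rfl
  have hmn := isDist_prod (margE P) hm n
  have hbij : ∀ f : (Fin n → A) × (Fin n → E) → ℝ,
      ∑ x, f x = ∑ s : Fin n → A × E, f (fun i => (s i).1, fun i => (s i).2) := fun f =>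
    (Equiv.sum_comp (Equiv.arrowProdEquivProdArrow (Fin n) (fun _ => A) (fun _ => E)) f).symm
  have hPn : IsDist (Pn P n) := by
    refine ⟨fun x => Finset.prod_nonneg fun i _ => hP.1 _, ?_⟩
    rw [hbij]
    exact (isDist_prod P hP n).2
  have h := oneShot (Pn P n) hPn _ hmn k (Real.exp (n * condEnt P + √n * R)) (Pol.eval (n : ℝ))
    (Real.exp_pos _)
  refine h.trans (add_le_add ?_ (le_of_eq ?_))
  · rw [hbij]
    refine mul_le_mul_of_nonneg_left (Finset.sum_le_sum fun s _ => ?_) (by norm_num)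
    have e1 : Pn P n (fun i => (s i).1, fun i => (s i).2) = ∏ i, P (s i) := rfl
    rw [e1]
    have h0 : 0 ≤ ∏ i, P (s i) := Finset.prod_nonneg fun i _ => hP.1 _
    refine mul_le_mul_of_nonneg_left ?_ h0
    by_cases hc : k * ∏ i, margE P (s i).2 < ∏ i, P (s i)
    swap
    · rw [if_neg hc]; split_ifs <;> norm_num
    rw [if_pos hc, if_pos]
    have hmp : 0 ≤ ∏ i, margE P (s i).2 := Finset.prod_nonneg fun i _ => hm.1 _
    have hpp : 0 < ∏ i, P (s i) := lt_of_le_of_lt (by positivity) hc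
    have hpi : ∀ i, 0 < P (s i) := fun i =>
      lt_of_le_of_ne (hP.1 _) fun h => hpp.ne' (Finset.prod_eq_zero (Finset.mem_univ i) h.symm)
    have hmi : ∀ i, 0 < margE P (s i).2 := fun i => margE_pos P hP.1 _ (hpi i)
    have hmpp : 0 < ∏ i, margE P (s i).2 := Finset.prod_pos fun i _ => hmi i
    have hlog : -(n * condEnt P + √n * (R + δ)) < ∑ i, Real.log (P (s i) / margE P (s i).2) := by
      rw [← Real.log_prod (fun i _ => (div_pos (hpi i) (hmi i)).ne'), Finset.prod_div_distrib,
        Real.lt_log_iff_exp_lt (div_pos hpp hmpp), lt_div_iff₀ hmpp]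
      exact hc
    have hg : ∑ i, gfun P (s i) ≤ √n * (R + δ) := by
      simp only [gfun, Finset.sum_sub_distrib, Finset.sum_neg_distrib]
      simp
      linarith
    have hsn : 0 < √(n : ℝ) := Real.sqrt_pos.2 (by exact_mod_cast hn)
    have hsV : 0 < √(Vval P) := Real.sqrt_pos.2 hV
    rw [Real.sqrt_mul (Nat.cast_nonneg n), inv_mul_eq_div, div_le_div_iff₀ (by positivity) hsV]
    nlinarith
  · rw [mul_assoc, ← Real.sqrt_mul (Real.exp_pos _).le, mul_comm, ← Real.sqrt_mul (by positivity)]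
    congr 1
    have : Real.exp (n * condEnt P + √n * R) * k = (Real.exp (δ * √n))⁻¹ := by
      rw [hk, ← Real.exp_add, ← Real.exp_neg]
      congr 1; ring
    rw [div_eq_mul_inv, ← this]
    ring

/-- Theorem `t3-16-b` of the paper (second-order part): the smoothing-of-min-
entropy bound at key length `n·H(A|E|P) + √n·R` is asymptotically bounded by
twice the Gaussian cumulative distribution function at `R/√V(P)`. -/
theorem statement19 {A E : Type*} [Fintype A] [Fintype E] [Nonempty A] [Nonempty E]
    (P : A × E → ℝ) (hP : IsDist P) (hV : 0 < Vval P) (R : ℝ)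
    (Pol : Polynomial ℝ) (hPol : ∀ n : ℕ, 0 < n → 0 < Pol.eval (n : ℝ)) :
    Filter.limsup (fun n : ℕ =>
        Delta_dmin (Real.exp (n * condEnt P + Real.sqrt (n : ℝ) * R))
          (Pol.eval (n : ℝ)) (Pn P n))
      Filter.atTop ≤
    2 * ∫ x in Set.Iic (R / Real.sqrt (Vval P)),
        (1 / Real.sqrt (2 * Real.pi)) * Real.exp (-x ^ 2 / 2) := by
  set F : ℝ → ℝ := fun u => ∫ x in Set.Iic u,
    (1 / Real.sqrt (2 * Real.pi)) * Real.exp (-x ^ 2 / 2) with hF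
  have key : ∀ δ > 0, Filter.limsup (fun n : ℕ =>
        Delta_dmin (Real.exp (n * condEnt P + Real.sqrt (n : ℝ) * R))
          (Pol.eval (n : ℝ)) (Pn P n)) Filter.atTop ≤ 2 * F ((R + δ) / √(Vval P)) := by
    intro δ hδ
    have h1 := (clt_main P hP hV ((R + δ) / √(Vval P))).const_mul 2
    have h2 := h1.add (pol_tendsto Pol δ hδ)
    rw [add_zero] at h2
    rw [← h2.limsup_eq]
    refine limsup_le_limsup ?_ ?_ ?_
    · filter_upwards [eventually_gt_atTop 0] with n hn
      exact step_bound P hP hV R δ Pol n hn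
    · exact isCoboundedUnder_le_of_le atTop (x := 0) fun n => Delta_dmin_nonneg _ _ _
    · exact h2.isBoundedUnder_le
  have hcont : Continuous F := gauss_cont
  have hlim : Tendsto (fun δ : ℝ => 2 * F ((R + δ) / √(Vval P))) (nhdsWithin 0 (Set.Ioi 0))
      (nhds (2 * F (R / √(Vval P)))) := by
    have : Continuous (fun δ : ℝ => 2 * F ((R + δ) / √(Vval P))) := by fun_prop
    have h := this.tendsto 0
    simp only [add_zero] at h
    exact h.mono_left nhdsWithin_le_nhds
  refine ge_of_tendsto hlim ?_
  filter_upwards [self_mem_nhdsWithin] with δ hδ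
  exact key δ hδ
end Hayashi
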